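/- arXiv:2504.14262 — 4 statements merged into one kernel-verified Lean document; each statement's English description precedes it below -/
import Mathlib

section
/- For any natural number l ≥ 1, the maximum over k ∈ {0,1,…,l} of the ratio binom(l,k)·(1/2)^l / N(k | l/2, l/4) is at most exp{φ(l)}, where N(x|μ,σ²) = (1/√(2πσ²))·exp(−(x−μ)²/(2σ²)) is the Gaussian density. -/
/-- `c_ζ = 1/(1+2ζ)² + 1/(1−2ζ)²`. -/
noncomputable def cZeta (ζ : ℝ) : ℝ := 1 / (1 + 2 * ζ) ^ 2 + 1 / (1 - 2 * ζ) ^ 2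

/-- `φ_ζ(l)`, the maximum of the three expressions from Takeishi et al. -/
noncomputable def phiZeta (ζ l : ℝ) : ℝ :=
  max (((3 / 16) * (cZeta ζ) ^ 2 + 1 / 12) / l)
    (max (-(4 * ζ ^ 4 / 3) * l + Real.log (l / 2) + 1 / (12 * l))
      (-(Real.log 2 - 1 / 2) * l + (1 / 2) * Real.log (Real.pi * l / 2)))

/-- `φ(l) = inf_{ζ ∈ (0,1/2)} φ_ζ(l)`. -/
noncomputable def phi (l : ℝ) : ℝ := ⨅ ζ : Set.Ioo (0 : ℝ) (1 / 2), phiZeta ζ l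

/-- `η = √(9/(8πe))`. -/
noncomputable def eta : ℝ := Real.sqrt (9 / (8 * Real.pi * Real.exp 1))

/-- The Gaussian density `N(x|μ,σ²) = (1/√(2πσ²))·exp(−(x−μ)²/(2σ²))`. -/
noncomputable def gaussDensity (μ s2 x : ℝ) : ℝ :=
  (1 / Real.sqrt (2 * Real.pi * s2)) * Real.exp (-(x - μ) ^ 2 / (2 * s2))

open Filter Topology Nat in
/-- The upper half of Robbins' form of Stirling's formula. -/
theorem log_factorial_le_stirling {n : ℕ} (hn : n ≠ 0) :
    Real.log (n ! : ℝ) ≤ n * Real.log n - n + Real.log n / 2 + Real.log (2 * Real.pi) / 2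
      + 1 / (12 * n) := by
  have hmono : Monotone fun m : ℕ ↦
      Real.log (Stirling.stirlingSeq (m + 1)) - 1 / (12 * ((m : ℝ) + 1)) := by
    refine monotone_nat_of_le_succ fun m ↦ ?_
    have h := Stirling.log_stirlingSeq_sdiff_le (m + 1)
    have e : (1 : ℝ) / (12 * ((m + 1 : ℕ) : ℝ) * (((m + 1 : ℕ) : ℝ) + 1))
        = 1 / (12 * ((m : ℝ) + 1)) - 1 / (12 * (((m + 1 : ℕ) : ℝ) + 1)) := by
      push_cast
      field_simp
      ring
    linarith
  have hlim : Tendsto (fun m : ℕ ↦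
      Real.log (Stirling.stirlingSeq (m + 1)) - 1 / (12 * ((m : ℝ) + 1))) atTop
      (𝓝 (Real.log √Real.pi - 0)) := by
    refine Tendsto.sub ?_ ?_
    · exact (Stirling.tendsto_stirlingSeq_sqrt_pi.comp (tendsto_add_atTop_nat 1)).log
        (by positivity)
    · have h := (tendsto_one_div_add_atTop_nhds_zero_nat (𝕜 := ℝ)).const_mul (1 / 12)
      simpa [mul_comm] using h
  obtain ⟨m, rfl⟩ := Nat.exists_eq_succ_of_ne_zero hn
  have h := hmono.ge_of_tendsto hlim m
  have hpos : (0 : ℝ) < ((m + 1 : ℕ) : ℝ) := by positivity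
  simp only [Nat.succ_eq_add_one] at *
  rw [Stirling.log_stirlingSeq_formula, Real.log_sqrt Real.pi_pos.le,
    Real.log_mul two_ne_zero hpos.ne', Real.log_div hpos.ne' (Real.exp_ne_zero 1),
    Real.log_exp] at h
  rw [Real.log_mul two_ne_zero Real.pi_pos.ne']
  push_cast at *
  linarith

/-- A fourth order lower bound for the entropy deficit, on the nonnegative half. -/
theorem sq_add_le_mul_log_of_nonneg {t : ℝ} (h0 : 0 ≤ t) (h1 : t < 1) :
    t ^ 2 + t ^ 4 / 6 ≤ (1 + t) * Real.log (1 + t) + (1 - t) * Real.log (1 - t) := by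
  have hderiv : ∀ x ∈ Set.Ico (0 : ℝ) 1, HasDerivAt
      (fun x : ℝ ↦ (1 + x) * Real.log (1 + x) + (1 - x) * Real.log (1 - x) - (x ^ 2 + x ^ 4 / 6))
      (Real.log (1 + x) - Real.log (1 - x) - (2 * x + 2 * x ^ 3 / 3)) x := by
    rintro x ⟨hx0, hx1⟩
    have hp : 1 + x ≠ 0 := by positivity
    have hm : 1 - x ≠ 0 := by linarith
    have dp : HasDerivAt (fun x : ℝ ↦ 1 + x) 1 x := (hasDerivAt_id x).const_add 1
    have dm : HasDerivAt (fun x : ℝ ↦ 1 - x) (-1) x := (hasDerivAt_id x).const_sub 1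
    refine HasDerivAt.congr_deriv (((dp.mul (dp.log hp)).add (dm.mul (dm.log hm))).sub
      ((hasDerivAt_pow 2 x).add ((hasDerivAt_pow 4 x).div_const 6))) ?_
    norm_num
    field_simp
    ring
  have hmono := monotoneOn_of_deriv_nonneg (convex_Ico (0 : ℝ) 1)
    (fun x hx ↦ (hderiv x hx).continuousAt.continuousWithinAt)
    (fun x hx ↦ (hderiv x (interior_subset hx)).differentiableAt.differentiableWithinAt)
    (fun x hx ↦ by
      have hx' := interior_subset hx
      rw [(hderiv x hx').deriv]
      have h := Real.sum_range_le_log_div hx'.1 hx'.2 2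
      rw [Real.log_div (by linarith [hx'.1]) (by linarith [hx'.2])] at h
      norm_num [Finset.sum_range_succ] at h
      linarith)
  have h := hmono (Set.left_mem_Ico.2 one_pos) ⟨h0, h1⟩ h0
  norm_num at h
  linarith

/-- A fourth order lower bound for the entropy deficit of a Bernoulli variable. -/
theorem sq_add_le_mul_log {t : ℝ} (h : |t| < 1) :
    t ^ 2 + t ^ 4 / 6 ≤ (1 + t) * Real.log (1 + t) + (1 - t) * Real.log (1 - t) := by
  obtain ⟨hl, hr⟩ := abs_lt.1 h
  rcases le_total 0 t with ht | ht
  · exact sq_add_le_mul_log_of_nonneg ht hr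
  · have h := sq_add_le_mul_log_of_nonneg (neg_nonneg.2 ht) (by linarith)
    rw [sub_neg_eq_add, ← sub_eq_add_neg] at h
    linarith [h, Even.neg_pow (by decide : Even 2) t, Even.neg_pow (by decide : Even 4) t]

/-- The logarithm of the ratio of the symmetric binomial probability to the Gaussian density. -/
theorem log_choose_div_gaussDensity {l k : ℕ} (hl : 1 ≤ l) (hk : k ≤ l) :
    Real.log ((l.choose k : ℝ) * (1 / 2) ^ l / gaussDensity ((l : ℝ) / 2) ((l : ℝ) / 4) (k : ℝ))
      = Real.log (l.choose k) - l * Real.log 2 + 1 / 2 * Real.log (Real.pi * l / 2)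
        + 2 * ((k : ℝ) - l / 2) ^ 2 / l := by
  have hl' : (0 : ℝ) < l := by exact_mod_cast hl
  have hc : (0 : ℝ) < l.choose k := by exact_mod_cast Nat.choose_pos hk
  have hp : 0 < 2 * Real.pi * ((l : ℝ) / 4) := by positivity
  have hs : 0 < √(2 * Real.pi * ((l : ℝ) / 4)) := Real.sqrt_pos.2 hp
  rw [gaussDensity, Real.log_div (by positivity) (by positivity),
    Real.log_mul hc.ne' (by positivity), Real.log_mul (by positivity) (Real.exp_ne_zero _),
    Real.log_exp, Real.log_pow, one_div, Real.log_inv, one_div, Real.log_inv,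
    Real.log_sqrt hp.le, show 2 * Real.pi * ((l : ℝ) / 4) = Real.pi * l / 2 by ring]
  field_simp
  ring

/-- Stirling's bound for the log-ratio away from the endpoints, in terms of the normalised
deviation `(a - b) / (a + b)`. -/
theorem log_choose_div_gaussDensity_le {a b : ℕ} (ha : 1 ≤ a) (hb : 1 ≤ b) {t : ℝ}
    (ht : t = ((a : ℝ) - b) / (a + b)) :
    Real.log (((a + b).choose a : ℝ) * (1 / 2) ^ (a + b) /
        gaussDensity (((a + b : ℕ) : ℝ) / 2) (((a + b : ℕ) : ℝ) / 4) (a : ℝ))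
      ≤ -(((a + b : ℕ) : ℝ) * t ^ 4 / 12) - 1 / 2 * Real.log (1 - t ^ 2)
        + 1 / (12 * ((a + b : ℕ) : ℝ)) := by
  have ha' : (0 : ℝ) < a := by exact_mod_cast ha
  have hb' : (0 : ℝ) < b := by exact_mod_cast hb
  rw [log_choose_div_gaussDensity (by omega) (by omega), Nat.cast_add_choose,
    Real.log_div (by positivity) (by positivity), Real.log_mul (by positivity) (by positivity)]
  have hn := log_factorial_le_stirling (n := a + b) (by omega)
  have hka := Stirling.le_log_factorial_stirling (n := a) (by omega)
  have hkb := Stirling.le_log_factorial_stirling (n := b) (by omega)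
  push_cast at *
  set n : ℝ := (a : ℝ) + b with hndef
  have hn0 : 0 < n := by positivity
  have e1 : 1 + t = 2 * a / n := by rw [ht]; field_simp; rw [hndef]; ring
  have e2 : 1 - t = 2 * b / n := by rw [ht]; field_simp; rw [hndef]; ring
  have l1 : Real.log (1 + t) = Real.log 2 + Real.log a - Real.log n := by
    rw [e1, Real.log_div (by positivity) hn0.ne', Real.log_mul two_ne_zero ha'.ne']
  have l2 : Real.log (1 - t) = Real.log 2 + Real.log b - Real.log n := by
    rw [e2, Real.log_div (by positivity) hn0.ne', Real.log_mul two_ne_zero hb'.ne']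
  have p1 : 0 < 1 + t := by rw [e1]; positivity
  have p2 : 0 < 1 - t := by rw [e2]; positivity
  have l3 : Real.log (1 - t ^ 2) = Real.log (1 + t) + Real.log (1 - t) := by
    rw [← Real.log_mul p1.ne' p2.ne']; ring_nf
  have hE := mul_le_mul_of_nonneg_left
    (sq_add_le_mul_log (abs_lt.2 ⟨by linarith, by linarith⟩ : |t| < 1)) (half_pos hn0).le
  have e3 : n / 2 * ((1 + t) * Real.log (1 + t) + (1 - t) * Real.log (1 - t))
      = a * Real.log (1 + t) + b * Real.log (1 - t) := by
    rw [e1, e2]; field_simp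
  have e4 : 2 * ((a : ℝ) - n / 2) ^ 2 / n = n / 2 * t ^ 2 := by
    rw [ht, hndef]; field_simp; ring
  have l4 : Real.log (Real.pi * n / 2) = Real.log (2 * Real.pi) + Real.log n - 2 * Real.log 2 := by
    rw [Real.log_div (by positivity) two_ne_zero, Real.log_mul Real.pi_pos.ne' hn0.ne',
      Real.log_mul two_ne_zero Real.pi_pos.ne']
    ring
  have e5 : (a : ℝ) * Real.log 2 + b * Real.log 2 = n * Real.log 2 := by rw [hndef]; ring
  have e6 : (a : ℝ) * Real.log n + b * Real.log n = n * Real.log n := by rw [hndef]; ring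
  rw [e3] at hE
  rw [l3, e4, l4]
  rw [l1, l2] at *
  linarith

/-- Near the centre, the deviation terms are controlled by `cZeta`. -/
theorem neg_mul_pow_sub_log_le {n t ζ : ℝ} (hn : 0 < n) (hζ : ζ ∈ Set.Ioo (0 : ℝ) (1 / 2))
    (ht : |t| ≤ 2 * ζ) :
    -(n * t ^ 4 / 12) - 1 / 2 * Real.log (1 - t ^ 2) ≤ 3 / 16 * cZeta ζ ^ 2 / n := by
  obtain ⟨h0, h1⟩ := hζ
  have hxy : t ^ 2 ≤ (2 * ζ) ^ 2 := sq_le_sq' (by linarith [neg_abs_le t]) ((le_abs_self t).trans ht)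
  have hy : (2 * ζ) ^ 2 < 1 := by nlinarith
  have hx : 0 < 1 - t ^ 2 := by linarith
  have hlog : -Real.log (1 - t ^ 2) ≤ t ^ 2 / (1 - t ^ 2) := by
    have h := Real.one_sub_inv_le_log_of_pos hx
    have e : t ^ 2 / (1 - t ^ 2) = (1 - t ^ 2)⁻¹ - 1 := by field_simp; ring
    linarith
  have hc : 2 / (1 - t ^ 2) ≤ cZeta ζ := by
    have hp : 0 < 1 + 2 * ζ := by linarith
    have hm : 0 < 1 - 2 * ζ := by linarith
    calc 2 / (1 - t ^ 2) ≤ 2 / (1 - (2 * ζ) ^ 2) := by gcongr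
      _ = 2 * (1 / (1 + 2 * ζ)) * (1 / (1 - 2 * ζ)) := by
        rw [show 1 - (2 * ζ) ^ 2 = (1 + 2 * ζ) * (1 - 2 * ζ) by ring]; field_simp
      _ ≤ (1 / (1 + 2 * ζ)) ^ 2 + (1 / (1 - 2 * ζ)) ^ 2 := two_mul_le_add_sq _ _
      _ = cZeta ζ := by simp [cZeta]
  have hamgm : t ^ 2 * cZeta ζ / 4 ≤ n * t ^ 4 / 12 + 3 / 16 * cZeta ζ ^ 2 / n := by
    have e : n * t ^ 4 / 12 + 3 / 16 * cZeta ζ ^ 2 / n - t ^ 2 * cZeta ζ / 4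
        = (2 * n * t ^ 2 - 3 * cZeta ζ) ^ 2 / (48 * n) := by field_simp; ring
    have : 0 ≤ (2 * n * t ^ 2 - 3 * cZeta ζ) ^ 2 / (48 * n) := by positivity
    linarith
  have hmul := mul_le_mul_of_nonneg_left hc (sq_nonneg t)
  have e : t ^ 2 * (2 / (1 - t ^ 2)) = 2 * (t ^ 2 / (1 - t ^ 2)) := by ring
  linarith

/-- At the endpoints the log-ratio is the third expression of `phiZeta`. -/
theorem log_gaussDensity_ratio_endpoint {l k : ℕ} (hl : 1 ≤ l) (hk : k = 0 ∨ k = l) :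
    Real.log ((l.choose k : ℝ) * (1 / 2) ^ l / gaussDensity ((l : ℝ) / 2) ((l : ℝ) / 4) (k : ℝ))
      = -(Real.log 2 - 1 / 2) * l + (1 / 2) * Real.log (Real.pi * l / 2) := by
  have hl' : (0 : ℝ) < l := by exact_mod_cast hl
  have hsq : 2 * ((k : ℝ) - l / 2) ^ 2 / l = l / 2 := by
    rcases hk with rfl | rfl
    · push_cast; field_simp; ring
    · field_simp; ring
  have hc : l.choose k = 1 := by rcases hk with rfl | rfl <;> simp
  rw [log_choose_div_gaussDensity hl (by omega), hsq, hc, Nat.cast_one, Real.log_one]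
  ring

/-- The log-ratio is bounded by `phiZeta ζ l` for every admissible `ζ`. -/
theorem log_gaussDensity_ratio_le_phiZeta {l k : ℕ} (hl : 1 ≤ l) (hk : k ≤ l) {ζ : ℝ}
    (hζ : ζ ∈ Set.Ioo (0 : ℝ) (1 / 2)) :
    Real.log ((l.choose k : ℝ) * (1 / 2) ^ l / gaussDensity ((l : ℝ) / 2) ((l : ℝ) / 4) (k : ℝ))
      ≤ phiZeta ζ l := by
  unfold phiZeta
  by_cases hend : k = 0 ∨ k = l
  · rw [log_gaussDensity_ratio_endpoint hl hend]
    exact (le_max_right _ _).trans (le_max_right _ _)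
  obtain ⟨b, rfl⟩ := Nat.exists_eq_add_of_le hk
  have ha : 1 ≤ k := by omega
  have hb : 1 ≤ b := by omega
  obtain ⟨t, ht⟩ : ∃ t : ℝ, t = ((k : ℝ) - b) / (k + b) := ⟨_, rfl⟩
  refine (log_choose_div_gaussDensity_le ha hb ht).trans ?_
  have hn : (0 : ℝ) < ((k + b : ℕ) : ℝ) := by exact_mod_cast hl
  rcases le_total |t| (2 * ζ) with hc | hc
  · refine le_trans ?_ (le_max_left _ _)
    have h := neg_mul_pow_sub_log_le hn hζ hc
    rw [add_div, show (1 / 12 : ℝ) / ((k + b : ℕ) : ℝ) = 1 / (12 * ((k + b : ℕ) : ℝ)) by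
      rw [div_div]]
    linarith
  · refine le_trans ?_ ((le_max_left _ _).trans (le_max_right _ _))
    have ht4 : (2 * ζ) ^ 4 ≤ t ^ 4 := by
      rw [← Even.pow_abs (by decide : Even 4) t]
      exact pow_le_pow_left₀ (by linarith [hζ.1]) hc 4
    have hmul := mul_le_mul_of_nonneg_left ht4 hn.le
    have hlog : -2 * Real.log (((k + b : ℕ) : ℝ) / 2) ≤ Real.log (1 - t ^ 2) := by
      have h1 : (1 : ℝ) ≤ k * b := by exact_mod_cast Nat.mul_pos ha hb
      have e : 1 - t ^ 2 = k * b * ((((k + b : ℕ) : ℝ) / 2) ^ 2)⁻¹ := by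
        rw [ht]; push_cast at *; field_simp; ring
      have h2 : ((((k + b : ℕ) : ℝ) / 2) ^ 2)⁻¹ ≤ 1 - t ^ 2 := by
        rw [e]; exact le_mul_of_one_le_left (by positivity) h1
      have h3 := Real.log_le_log (by positivity) h2
      rw [Real.log_inv, Real.log_pow] at h3
      push_cast at *
      linarith
    linarith

/-- For any natural number `l ≥ 1`, the maximum over `k ∈ {0,…,l}` of
`binom(l,k)·(1/2)^l / N(k | l/2, l/4)` is at most `exp(φ(l))`. -/
theorem stmt_3 (l : ℕ) (hl : 1 ≤ l) :
    ∀ k ≤ l, (l.choose k : ℝ) * (1 / 2) ^ l / gaussDensity ((l : ℝ) / 2) ((l : ℝ) / 4) (k : ℝ)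
      ≤ Real.exp (phi l) := by
  intro k hk
  refine (Real.le_exp_log _).trans (Real.exp_le_exp.2 ?_)
  have : Nonempty (Set.Ioo (0 : ℝ) (1 / 2)) := ⟨⟨1 / 4, by norm_num, by norm_num⟩⟩
  exact le_ciInf fun ζ ↦ log_gaussDensity_ratio_le_phiZeta hl hk ζ.2
end

section
/- For every natural number l ≥ 1000, φ(l) ≤ 5/l. -/
theorem bddBelow_range_phiZeta (l : ℝ) :
    BddBelow (Set.range fun ζ : Set.Ioo (0 : ℝ) (1 / 2) => phiZeta ζ l) := by
  refine ⟨-(Real.log 2 - 1 / 2) * l + (1 / 2) * Real.log (Real.pi * l / 2), ?_⟩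
  rintro _ ⟨ζ, rfl⟩
  exact (le_max_right _ _).trans (le_max_right _ _)

theorem phi_le_phiZeta {ζ : ℝ} (hζ : ζ ∈ Set.Ioo (0 : ℝ) (1 / 2)) (l : ℝ) :
    phi l ≤ phiZeta ζ l :=
  ciInf_le (bddBelow_range_phiZeta l) ⟨ζ, hζ⟩

theorem log_half_le {l : ℝ} (hl : 0 < l) :
    Real.log (l / 2) ≤ 9 * Real.log 2 + (l / 1024 - 1) := by
  have h : l / 2 = 2 ^ 9 * (l / 1024) := by ring
  rw [h, Real.log_mul (by norm_num) (by positivity), Real.log_pow]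
  have := Real.log_le_sub_one_of_pos (show 0 < l / 1024 by positivity)
  push_cast
  linarith

theorem log_pi_mul_half_le {l : ℝ} (hl : 0 < l) :
    Real.log (Real.pi * l / 2) ≤ 2 * Real.log 2 + Real.log (l / 2) := by
  rw [mul_div_assoc, Real.log_mul Real.pi_ne_zero (by positivity)]
  have h : Real.log Real.pi ≤ Real.log (2 ^ 2) :=
    Real.log_le_log Real.pi_pos (by linarith [Real.pi_le_four])
  rw [Real.log_pow] at h
  push_cast at h
  linarith

theorem phiZeta_le_five_div {l : ℝ} (hl : 1000 ≤ l) : phiZeta (53 / 200) l ≤ 5 / l := by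
  have hpos : 0 < l := by linarith
  have hnonneg : 0 ≤ 5 / l := by positivity
  have hlog := log_half_le hpos
  have hlog_pi := log_pi_mul_half_le hpos
  have hlt := Real.log_two_lt_d9
  have hgt := Real.log_two_gt_d9
  refine max_le ?_ (max_le (le_trans ?_ hnonneg) (le_trans ?_ hnonneg))
  · gcongr
    norm_num [cZeta]
  · have hsmall : 1 / (12 * l) ≤ 1 / 12 :=
      one_div_le_one_div_of_le (by norm_num) (by linarith)
    norm_num at hsmall ⊢
    linarith
  · have hmul : (1 / 10) * l ≤ (Real.log 2 - 1 / 2) * l := by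
      gcongr
      linarith
    linarith

/-- For every natural number `l ≥ 1000`, `φ(l) ≤ 5/l`. -/
theorem stmt_4 : ∀ l : ℕ, 1000 ≤ l → phi l ≤ 5 / (l : ℝ) := by
  intro l hl
  exact (phi_le_phiZeta (by norm_num) _).trans (phiZeta_le_five_div (by exact_mod_cast hl))
end

section
/- Let n be a natural number, h = 2/√n, and X = { h(k − n/2) : k = 0,1,…,n }. For any s² > 0 and μ ∈ ℝ, define I_d = h·Σ_{x∈X} exp{−(s²/2)(x−μ)²} and I_c = ∫_{−∞}^{∞} exp{−(s²/2)(x−μ)²} dx = √(2π/s²). Then I_d ≤ (1 + ηs²/n)·I_c, where η = √(9/(8πe)). -/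
theorem cosKernel_le (a : ℝ) {t : ℝ} (ht : 0 < t) :
    HurwitzZeta.cosKernel a t ≤ 1 + 4 / (3 * (Real.pi * t)) := by
  set x := Real.pi * t with hx
  have hx0 : 0 < x := by positivity
  have hr1 : Real.exp (-(3 * x)) < 1 := Real.exp_zero ▸ Real.exp_lt_exp.mpr (by linarith)
  have hgeom := (hasSum_geometric_of_lt_one (Real.exp_pos (-(3 * x))).le hr1).mul_left
    (2 * Real.exp (-x))
  have hle := hasSum_le (fun n : ℕ ↦ ?_) (HurwitzZeta.hasSum_nat_cosKernel₀ a ht) hgeom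
  · have hbound : 2 * Real.exp (-x) * (1 - Real.exp (-(3 * x)))⁻¹ ≤ 4 / (3 * x) := by
      rw [← div_eq_mul_inv, div_le_div_iff₀ (by linarith) (by positivity)]
      have h3 : Real.exp (-(3 * x)) * (1 + 3 * x) ≤ 1 := by
        calc _ ≤ Real.exp (-(3 * x)) * Real.exp (3 * x) := by
              gcongr; linarith [Real.add_one_le_exp (3 * x)]
          _ = 1 := by rw [← Real.exp_add]; simp
      have h1 : Real.exp (-x) * (1 + x + x ^ 2 / 2) ≤ 1 := by
        calc _ ≤ Real.exp (-x) * Real.exp x := by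
              gcongr; exact Real.quadratic_le_exp_of_nonneg hx0.le
          _ = 1 := by rw [← Real.exp_add]; simp
      have h2 : Real.exp (-x) * (1 + 3 * x) ≤ 2 := by
        have hq : 0 ≤ x ^ 2 - x + 1 := by nlinarith [sq_nonneg (x - 1)]
        nlinarith [mul_nonneg (Real.exp_pos (-x)).le hq]
      have h4 : 3 * x ≤ (1 - Real.exp (-(3 * x))) * (1 + 3 * x) := by linarith
      calc 2 * Real.exp (-x) * (3 * x)
          ≤ 2 * Real.exp (-x) * ((1 - Real.exp (-(3 * x))) * (1 + 3 * x)) := by gcongr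
        _ = 2 * (1 - Real.exp (-(3 * x))) * (Real.exp (-x) * (1 + 3 * x)) := by ring
        _ ≤ 2 * (1 - Real.exp (-(3 * x))) * 2 := by
            have : 0 ≤ 1 - Real.exp (-(3 * x)) := by linarith
            gcongr
        _ = 4 * (1 - Real.exp (-(3 * x))) := by ring
    linarith
  · rw [← Real.exp_nat_mul, mul_assoc 2 (Real.exp _), ← Real.exp_add, mul_assoc 2]
    gcongr 2 * ?_
    calc _ ≤ 1 * Real.exp (-Real.pi * ((n : ℝ) + 1) ^ 2 * t) := by
          gcongr; exact Real.cos_le_one _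
      _ ≤ _ := by
          rw [one_mul, Real.exp_le_exp]
          have hn : (n : ℝ) ≤ (n : ℝ) ^ 2 := by exact_mod_cast Nat.le_self_pow two_ne_zero n
          have : -Real.pi * ((n : ℝ) + 1) ^ 2 * t = -x * ((n : ℝ) + 1) ^ 2 := by rw [hx]; ring
          rw [this]
          nlinarith

theorem sum_range_gaussian_le (N : ℕ) (ν : ℝ) {t : ℝ} (ht : 0 < t) :
    ∑ k ∈ Finset.range N, Real.exp (-Real.pi * ((k : ℝ) - ν) ^ 2 * t) ≤
      (1 + 4 * t / (3 * Real.pi)) / √t := by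
  have hsum := HurwitzZeta.hasSum_int_evenKernel (-ν) ht
  have hle := sum_le_hasSum ((Finset.range N).map Nat.castEmbedding)
    (fun i _ ↦ (Real.exp_pos _).le) hsum
  rw [Finset.sum_map, HurwitzZeta.evenKernel_functional_equation, ← Real.sqrt_eq_rpow] at hle
  have hcos := cosKernel_le (-ν) (one_div_pos.mpr ht)
  calc _ ≤ 1 / √t * HurwitzZeta.cosKernel (-ν : ℝ) (1 / t) := by
        simpa [sub_eq_add_neg] using hle
    _ ≤ 1 / √t * (1 + 4 / (3 * (Real.pi * (1 / t)))) := by gcongr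
    _ = _ := by field_simp

theorem eight_div_three_mul_pi_sq_le_eta : 8 / (3 * Real.pi ^ 2) ≤ eta := by
  have hpi := Real.pi_gt_three
  have hpi' := Real.pi_lt_d2
  have he := Real.exp_one_lt_d9
  calc 8 / (3 * Real.pi ^ 2) ≤ 8 / (3 * 3 ^ 2) := by gcongr
    _ ≤ 3 / 10 := by norm_num
    _ ≤ eta := by
      unfold eta
      apply Real.le_sqrt_of_sq_le
      rw [le_div_iff₀ (by positivity)]
      nlinarith [Real.exp_pos 1]

theorem integral_gaussian_shift (s2 μ : ℝ) :
    (∫ x : ℝ, Real.exp (-(s2 / 2) * (x - μ) ^ 2)) = √(2 * Real.pi / s2) := by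
  rw [MeasureTheory.integral_sub_right_eq_self (fun x ↦ Real.exp (-(s2 / 2) * x ^ 2)) μ,
    integral_gaussian]
  congr 1
  rw [div_div_eq_mul_div, mul_comm]

/-- Riemann-sum comparison (Takeishi–Takeuchi 2019): with `h = 2/√n` and
`X = {h(k − n/2) : k = 0,…,n}`, for any `s² > 0` and `μ ∈ ℝ`,
`I_d = h·Σ_{x∈X} exp{−(s²/2)(x−μ)²}` satisfies
`I_d ≤ (1 + ηs²/n)·I_c` where `I_c = ∫_ℝ exp{−(s²/2)(x−μ)²} dx = √(2π/s²)`. -/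
theorem stmt_5 (n : ℕ) (hn : 0 < n) (s2 : ℝ) (hs2 : 0 < s2) (μ : ℝ) :
    ((∫ x : ℝ, Real.exp (-(s2 / 2) * (x - μ) ^ 2)) = Real.sqrt (2 * Real.pi / s2)) ∧
    (2 / Real.sqrt n) * ∑ k ∈ Finset.range (n + 1),
        Real.exp (-(s2 / 2) * ((2 / Real.sqrt n) * ((k : ℝ) - (n : ℝ) / 2) - μ) ^ 2)
      ≤ (1 + eta * s2 / n) * ∫ x : ℝ, Real.exp (-(s2 / 2) * (x - μ) ^ 2) := by
  refine ⟨integral_gaussian_shift s2 μ, ?_⟩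
  rw [integral_gaussian_shift]
  have hn' : (0 : ℝ) < n := by exact_mod_cast hn
  have hsq : √(n : ℝ) ^ 2 = n := Real.sq_sqrt hn'.le
  have hs : 0 < √(n : ℝ) := Real.sqrt_pos.mpr hn'
  set t := 2 * s2 / (Real.pi * n) with ht_def
  have ht : 0 < t := by positivity
  have hexp (k : ℕ) :
      -(s2 / 2) * ((2 / √(n : ℝ)) * ((k : ℝ) - (n : ℝ) / 2) - μ) ^ 2 =
        -Real.pi * ((k : ℝ) - ((n : ℝ) / 2 + μ * √(n : ℝ) / 2)) ^ 2 * t := by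
    rw [ht_def]
    generalize √(n : ℝ) = r at hsq hs
    rw [← hsq]
    field_simp
    ring
  have hI : 2 / √(n : ℝ) / √t = √(2 * Real.pi / s2) := by
    symm
    rw [Real.sqrt_eq_iff_mul_self_eq (by positivity) (by positivity), ← sq, div_pow, div_pow, hsq,
      Real.sq_sqrt ht.le, ht_def]
    field_simp
  simp_rw [hexp]
  calc _ ≤ 2 / √(n : ℝ) * ((1 + 4 * t / (3 * Real.pi)) / √t) := by
        gcongr; exact sum_range_gaussian_le _ _ ht
    _ = (1 + 8 / (3 * Real.pi ^ 2) * s2 / n) * √(2 * Real.pi / s2) := by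
        rw [← hI, ht_def]; field_simp; ring
    _ ≤ _ := by
        gcongr; exact eight_div_three_mul_pi_sq_le_eta
end

section
/- Let n be a natural number, h = 2/√n, and X = { h(k − n/2) : k = 0,1,…,n }. Let A be a strictly positive definite 2×2 real matrix and, for x = (x₁,x₂)ᵀ, define I_d = ∫_{−∞}^{∞} h·Σ_{x₁∈X} exp{−xᵀA x/2} dx₂ and I_c = ∫_{−∞}^{∞}∫_{−∞}^{∞} exp{−xᵀA x/2} dx₁ dx₂. Then I_d ≤ (1 + ηA₁₁/n)·I_c, where A₁₁ is the (1,1) entry of A and η = √(9/(8πe)). -/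
open Matrix

/-- The pointwise bound `exp (-x) ≤ 1 / (e x)` for `x > 0`. -/
lemma exp_neg_le_exp_neg_one_div {x : ℝ} (hx : 0 < x) :
    Real.exp (-x) ≤ Real.exp (-1) / x := by
  rw [le_div_iff₀ hx]
  have h := Real.add_one_le_exp (x - 1)
  calc Real.exp (-x) * x ≤ Real.exp (-x) * Real.exp (x - 1) := by gcongr; linarith
    _ = Real.exp (-1) := by rw [← Real.exp_add]; ring_nf

lemma hasSum_int_one_div_sq : HasSum (fun m : ℤ => 1 / (m : ℝ) ^ 2) (Real.pi ^ 2 / 3) := by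
  have h := HasSum.of_nat_of_neg (f := fun m : ℤ => 1 / (m : ℝ) ^ 2)
    (by simpa using hasSum_zeta_two) (by simpa using hasSum_zeta_two)
  have e : Real.pi ^ 2 / 6 + Real.pi ^ 2 / 6 - 1 / (((0 : ℤ) : ℝ)) ^ 2 = Real.pi ^ 2 / 3 := by
    norm_num
    ring
  rwa [e] at h

lemma hasSum_gaussian_majorant (a : ℝ) :
    HasSum (fun m : ℤ => (if m = 0 then 1 else 0) +
      Real.exp (-1) / (Real.pi * a) * (1 / (m : ℝ) ^ 2))
      (1 + Real.exp (-1) / (Real.pi * a) * (Real.pi ^ 2 / 3)) :=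
  (hasSum_ite_eq 0 1).add (hasSum_int_one_div_sq.mul_left _)

lemma gaussian_le_majorant {a : ℝ} (ha : 0 < a) (m : ℤ) :
    Real.exp (-Real.pi * a * (m : ℝ) ^ 2) ≤ (if m = 0 then 1 else 0) +
      Real.exp (-1) / (Real.pi * a) * (1 / (m : ℝ) ^ 2) := by
  rcases eq_or_ne m 0 with rfl | hm
  · simp
  · have hm' : (0 : ℝ) < (m : ℝ) ^ 2 := by positivity
    have h := exp_neg_le_exp_neg_one_div (x := Real.pi * a * (m : ℝ) ^ 2) (by positivity)
    rw [if_neg hm, zero_add, div_mul_div_comm, mul_one]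
    simpa [neg_mul] using h

lemma summable_exp_neg_mul_int_sq {a : ℝ} (ha : 0 < a) :
    Summable (fun m : ℤ => Real.exp (-Real.pi * a * (m : ℝ) ^ 2)) :=
  .of_nonneg_of_le (fun _ => (Real.exp_pos _).le) (gaussian_le_majorant ha)
    (hasSum_gaussian_majorant a).summable

lemma tsum_exp_neg_mul_int_sq_le {a : ℝ} (ha : 0 < a) :
    ∑' m : ℤ, Real.exp (-Real.pi * a * (m : ℝ) ^ 2) ≤
      1 + Real.exp (-1) / (Real.pi * a) * (Real.pi ^ 2 / 3) := by
  rw [← (hasSum_gaussian_majorant a).tsum_eq]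
  exact (summable_exp_neg_mul_int_sq ha).tsum_le_tsum (gaussian_le_majorant ha)
    (hasSum_gaussian_majorant a).summable

lemma summable_exp_neg_mul_int_add_sq {c : ℝ} (hc : 0 < c) (β : ℝ) :
    Summable (fun m : ℤ => Real.exp (-c * ((m : ℝ) + β) ^ 2)) := by
  have hs := (summable_exp_neg_mul_int_sq (a := c / (2 * Real.pi)) (by positivity)).mul_left
    (Real.exp (c * β ^ 2))
  refine .of_nonneg_of_le (fun _ => (Real.exp_pos _).le) (fun m => ?_) hs
  rw [← Real.exp_add, Real.exp_le_exp]
  have : -Real.pi * (c / (2 * Real.pi)) * (m : ℝ) ^ 2 = -(c / 2) * (m : ℝ) ^ 2 := by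
    field_simp
  rw [this]
  nlinarith [mul_nonneg hc.le (sq_nonneg ((m : ℝ) + 2 * β))]

/-- Poisson summation bounds a shifted Gaussian sum by the dual unshifted one. -/
lemma tsum_exp_neg_mul_int_add_sq_le {a : ℝ} (ha : 0 < a) (β : ℝ) :
    ∑' m : ℤ, Real.exp (-(Real.pi / a) * ((m : ℝ) + β) ^ 2) ≤
      Real.sqrt a * ∑' m : ℤ, Real.exp (-Real.pi * a * (m : ℝ) ^ 2) := by
  have key := Complex.tsum_exp_neg_quadratic (a := (a : ℂ)) (by simpa using ha)
    (-Complex.I * β)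
  have hR : ∀ m : ℤ, Complex.exp (-Real.pi / a * (m + Complex.I * (-Complex.I * β)) ^ 2) =
      ((Real.exp (-(Real.pi / a) * ((m : ℝ) + β) ^ 2) : ℝ) : ℂ) := by
    intro m
    have : Complex.I * (-Complex.I * β) = β := by
      rw [← mul_assoc]; simp
    rw [this]
    push_cast
    ring_nf
  have hsq : (a : ℂ) ^ (1 / 2 : ℂ) = ((Real.sqrt a : ℝ) : ℂ) := by
    rw [Real.sqrt_eq_rpow, Complex.ofReal_cpow ha.le]; norm_num
  have hnorm : ∀ m : ℤ,
      ‖Complex.exp (-Real.pi * a * m ^ 2 + 2 * Real.pi * (-Complex.I * β) * m)‖ =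
        Real.exp (-Real.pi * a * (m : ℝ) ^ 2) := by
    intro m
    rw [Complex.norm_exp]
    congr 1
    simp [pow_two]
  simp_rw [hR] at key
  rw [hsq, ← Complex.ofReal_tsum] at key
  have hpos := Real.sqrt_pos.2 ha
  have h1 := norm_tsum_le_tsum_norm (f := fun m : ℤ =>
    Complex.exp (-Real.pi * a * m ^ 2 + 2 * Real.pi * (-Complex.I * β) * m))
    (by simpa only [hnorm] using summable_exp_neg_mul_int_sq ha)
  simp only [hnorm] at h1
  rw [key, ← Complex.ofReal_one, ← Complex.ofReal_div, ← Complex.ofReal_mul,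
    Complex.norm_real] at h1
  have h2 := (le_abs_self _).trans h1
  rwa [one_div, inv_mul_le_iff₀ hpos] at h2

lemma sum_range_exp_neg_mul_add_sq_le {a : ℝ} (ha : 0 < a) (β : ℝ) (N : ℕ) :
    ∑ k ∈ Finset.range N, Real.exp (-(Real.pi / a) * ((k : ℝ) + β) ^ 2) ≤
      Real.sqrt a * (1 + Real.exp (-1) / (Real.pi * a) * (Real.pi ^ 2 / 3)) := by
  have hs := summable_exp_neg_mul_int_add_sq (c := Real.pi / a) (by positivity) β
  have h := hs.sum_le_tsum ((Finset.range N).map Nat.castEmbedding)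
    (fun _ _ => (Real.exp_pos _).le)
  rw [Finset.sum_map] at h
  simp only [Nat.castEmbedding_apply, Int.cast_natCast] at h
  exact h.trans ((tsum_exp_neg_mul_int_add_sq_le ha β).trans
    (mul_le_mul_of_nonneg_left (tsum_exp_neg_mul_int_sq_le ha) (Real.sqrt_nonneg _)))

lemma two_div_three_mul_exp_neg_one_le_eta : 2 / 3 * Real.exp (-1) ≤ eta := by
  refine Real.le_sqrt_of_sq_le ?_
  have he := Real.exp_one_gt_d9
  have hp := Real.pi_lt_four
  have hp0 := Real.pi_pos
  rw [Real.exp_neg, le_div_iff₀ (by positivity)]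
  field_simp
  nlinarith

/-- For `s > 0`, the Riemann sum of `exp (-s x² / 2)` at scale `2 / √n` is close to its integral. -/
lemma riemann_sum_gaussian_le {n : ℕ} (hn : 0 < n) {s : ℝ} (hs : 0 < s) :
    (2 / Real.sqrt n) * ∑ k ∈ Finset.range (n + 1),
        Real.exp (-(s / 2) * ((2 / Real.sqrt n) * ((k : ℝ) - (n : ℝ) / 2)) ^ 2) ≤
      (1 + eta * s / n) * Real.sqrt (Real.pi / (s / 2)) := by
  have hn' : (0 : ℝ) < n := by exact_mod_cast hn
  have hp := Real.pi_pos
  set a : ℝ := Real.pi * n / (2 * s) with ha_def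
  have ha : 0 < a := by positivity
  have h := sum_range_exp_neg_mul_add_sq_le ha (-(n / 2 : ℝ)) (n + 1)
  have hterm : ∀ k : ℕ, -(s / 2) * ((2 / Real.sqrt n) * ((k : ℝ) - (n : ℝ) / 2)) ^ 2 =
      -(Real.pi / a) * ((k : ℝ) + -(n / 2 : ℝ)) ^ 2 := by
    intro k
    rw [mul_pow, div_pow, Real.sq_sqrt hn'.le, ha_def]
    field_simp
    ring
  have hscale : (2 / Real.sqrt n) * Real.sqrt a = Real.sqrt (Real.pi / (s / 2)) := by
    have : a = (Real.pi / (s / 2)) * (n / 2 ^ 2) := by rw [ha_def]; field_simp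
    rw [this, Real.sqrt_mul (by positivity), Real.sqrt_div hn'.le, Real.sqrt_sq (by norm_num)]
    have := Real.sqrt_pos.2 hn'
    field_simp
  have hcoef : Real.exp (-1) / (Real.pi * a) * (Real.pi ^ 2 / 3) ≤ eta * s / n := by
    have : Real.exp (-1) / (Real.pi * a) * (Real.pi ^ 2 / 3) =
        2 / 3 * Real.exp (-1) * s / n := by
      rw [ha_def]; field_simp
    rw [this]
    gcongr
    exact two_div_three_mul_exp_neg_one_le_eta
  simp_rw [hterm]
  calc _ ≤ (2 / Real.sqrt n) * (Real.sqrt a *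
        (1 + Real.exp (-1) / (Real.pi * a) * (Real.pi ^ 2 / 3))) := by gcongr
    _ = (1 + Real.exp (-1) / (Real.pi * a) * (Real.pi ^ 2 / 3)) *
        Real.sqrt (Real.pi / (s / 2)) := by rw [← hscale]; ring
    _ ≤ _ := by gcongr

lemma exp_quadratic_form_eq {A : Matrix (Fin 2) (Fin 2) ℝ} (hA : A.PosDef) (x y : ℝ) :
    Real.exp (-(![x, y] ⬝ᵥ (A *ᵥ ![x, y])) / 2) =
      Real.exp (-((A 0 0 - A 0 1 ^ 2 / A 1 1) / 2) * x ^ 2) *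
        Real.exp (-(A 1 1 / 2) * (y + A 0 1 * x / A 1 1) ^ 2) := by
  have hd : A 1 1 ≠ 0 := (hA.diag_pos (i := 1)).ne'
  have hsymm : A 1 0 = A 0 1 := by simpa using hA.isHermitian.apply 0 1
  rw [← Real.exp_add]
  congr 1
  simp [Matrix.mulVec, dotProduct, Fin.sum_univ_two, hsymm]
  field_simp
  ring

/-- Two-dimensional Riemann-sum comparison (Takeishi–Takeuchi 2019): with `h = 2/√n`,
`X = {h(k − n/2) : k = 0,…,n}` and a strictly positive definite `2×2` matrix `A`,
`I_d = ∫ h·Σ_{x₁∈X} exp{−xᵀAx/2} dx₂ ≤ (1 + ηA₁₁/n)·I_c` where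
`I_c = ∬ exp{−xᵀAx/2} dx₁ dx₂`. -/
theorem stmt_6 (n : ℕ) (hn : 0 < n) (A : Matrix (Fin 2) (Fin 2) ℝ) (hA : A.PosDef) :
    (∫ x2 : ℝ, (2 / Real.sqrt n) * ∑ k ∈ Finset.range (n + 1),
        Real.exp (-(![(2 / Real.sqrt n) * ((k : ℝ) - (n : ℝ) / 2), x2] ⬝ᵥ
          (A *ᵥ ![(2 / Real.sqrt n) * ((k : ℝ) - (n : ℝ) / 2), x2])) / 2))
      ≤ (1 + eta * A 0 0 / n) *
        ∫ x1 : ℝ, ∫ x2 : ℝ, Real.exp (-(![x1, x2] ⬝ᵥ (A *ᵥ ![x1, x2])) / 2) := by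
  have hd : 0 < A 1 1 := hA.diag_pos
  have hsymm : A 1 0 = A 0 1 := by simpa using hA.isHermitian.apply 0 1
  have hs : 0 < A 0 0 - A 0 1 ^ 2 / A 1 1 := by
    have hdet := hA.det_pos
    rw [Matrix.det_fin_two, hsymm] at hdet
    rw [sub_pos, div_lt_iff₀ hd]
    nlinarith
  have hsa : A 0 0 - A 0 1 ^ 2 / A 1 1 ≤ A 0 0 := sub_le_self _ (by positivity)
  have hinner : ∀ c : ℝ, ∫ y : ℝ, Real.exp (-(A 1 1 / 2) * (y + c) ^ 2) =
      Real.sqrt (Real.pi / (A 1 1 / 2)) := fun c => by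
    rw [MeasureTheory.integral_add_right_eq_self
      (fun y : ℝ => Real.exp (-(A 1 1 / 2) * y ^ 2)), integral_gaussian]
  have hint : ∀ c : ℝ, MeasureTheory.Integrable
      (fun y : ℝ => Real.exp (-(A 1 1 / 2) * (y + c) ^ 2)) := fun c =>
    (integrable_exp_neg_mul_sq (half_pos hd)).comp_add_right c
  simp_rw [exp_quadratic_form_eq hA]
  rw [MeasureTheory.integral_const_mul,
    MeasureTheory.integral_finsetSum _ (fun k _ => (hint _).const_mul _)]
  simp_rw [MeasureTheory.integral_const_mul, hinner]
  rw [MeasureTheory.integral_mul_const, integral_gaussian, ← Finset.sum_mul, ← mul_assoc,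
    ← mul_assoc]
  refine mul_le_mul_of_nonneg_right ?_ (Real.sqrt_nonneg _)
  refine (riemann_sum_gaussian_le hn hs).trans ?_
  have heta : 0 ≤ eta := Real.sqrt_nonneg _
  gcongr
end
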